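/- Fix α > 0 and consider the VAE energy L for the dataset x⁽¹⁾ = (1,1), x⁽²⁾ = (−1,−1) as defined in the context. The posterior-collapsed configuration W = (0,0), b = (0,0) (the empirical data mean), γ = 1 (the empirical data variance γ̄ = (1/(nd))Σᵢ‖x⁽ⁱ⁾ − x̄‖₂² with n = d = 2), μ⁽¹⁾ = μ⁽²⁾ = 0, σ⁽¹⁾ = σ⁽²⁾ = 1 is a strict local minimum of L over all parameters (W, b, γ, μ⁽¹⁾, μ⁽²⁾, σ⁽¹⁾, σ⁽²⁾). -/

import Mathlib

open MeasureTheory ProbabilityTheory Real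

/-- The soft-threshold operator `π_α(u) = sign(u)·(|u| - α)₊`. -/
noncomputable def softThreshold (α u : ℝ) : ℝ :=
  Real.sign u * max (|u| - α) 0

/-- The two data points of the toy dataset: `x⁽¹⁾ = (1,1)`, `x⁽²⁾ = (-1,-1)`. -/
def dataPt : Fin 2 → Fin 2 → ℝ := ![![1, 1], ![-1, -1]]

/-- Parameter space of the toy VAE: `(W, b, γ, μ, σ)` with `W, b ∈ ℝ²`, decoder
variance `γ ∈ ℝ`, encoder means `μ = (μ⁽¹⁾, μ⁽²⁾)` and encoder standard
deviations `σ = (σ⁽¹⁾, σ⁽²⁾)`. -/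
abbrev VAEParams : Type :=
  (Fin 2 → ℝ) × (Fin 2 → ℝ) × ℝ × (Fin 2 → ℝ) × (Fin 2 → ℝ)

/-- The VAE energy for the dataset `x⁽¹⁾ = (1,1)`, `x⁽²⁾ = (-1,-1)` in `ℝ²` with a
one-dimensional latent space:
`L = Σ_{i=1}^{2} { (1/γ)·E_{ε~N(0,1)} ‖x⁽ⁱ⁾ - π_α(W·(μ⁽ⁱ⁾ + σ⁽ⁱ⁾ε)) - b‖₂²
      + 2 log γ + (σ⁽ⁱ⁾)² - log (σ⁽ⁱ⁾)² + (μ⁽ⁱ⁾)² }`. -/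
noncomputable def vaeEnergy (α : ℝ) (p : VAEParams) : ℝ :=
  ∑ i : Fin 2,
    ((1 / p.2.2.1) * (∫ ε, (∑ j : Fin 2,
        (dataPt i j - softThreshold α (p.1 j * (p.2.2.2.1 i + p.2.2.2.2 i * ε))
          - p.2.1 j) ^ 2) ∂(gaussianReal 0 1))
      + 2 * Real.log p.2.2.1 + (p.2.2.2.2 i) ^ 2
      - Real.log ((p.2.2.2.2 i) ^ 2) + (p.2.2.2.1 i) ^ 2)

/-- The posterior-collapsed configuration: `W = (0,0)`, `b = (0,0)` (the
empirical data mean), `γ = 1` (the empirical data variance), `μ⁽¹⁾ = μ⁽²⁾ = 0`,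
`σ⁽¹⁾ = σ⁽²⁾ = 1`. -/
noncomputable def collapsedConfig : VAEParams :=
  (fun _ => 0, fun _ => 0, 1, fun _ => 0, fun _ => 1)

theorem softThreshold_eq_sub {α : ℝ} (hα : 0 < α) (u : ℝ) :
    softThreshold α u = max (u - α) 0 - max (-u - α) 0 := by
  unfold softThreshold
  rcases lt_trichotomy u 0 with h | rfl | h
  · rw [Real.sign_of_neg h, abs_of_neg h, max_eq_right (by linarith : u - α ≤ 0)]; ring
  · simp
  · rw [Real.sign_of_pos h, abs_of_pos h, max_eq_right (by linarith : -u - α ≤ 0)]; ring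

theorem continuous_softThreshold {α : ℝ} (hα : 0 < α) : Continuous (softThreshold α) := by
  rw [show softThreshold α = fun u => max (u - α) 0 - max (-u - α) 0 from
    funext (softThreshold_eq_sub hα)]
  fun_prop

theorem softThreshold_neg (α u : ℝ) : softThreshold α (-u) = -softThreshold α u := by
  simp [softThreshold, Real.sign_neg]

theorem softThreshold_eq_zero {α u : ℝ} (h : |u| ≤ α) : softThreshold α u = 0 := by
  simp [softThreshold, h]

theorem softThreshold_pos {α u : ℝ} (hα : 0 < α) (h : α < u) : 0 < softThreshold α u := by
  rw [softThreshold_eq_sub hα, max_eq_left (by linarith), max_eq_right (by linarith)]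
  linarith

theorem abs_softThreshold_le {α : ℝ} (hα : 0 < α) (u : ℝ) : |softThreshold α u| ≤ |u| := by
  rw [softThreshold_eq_sub hα, abs_le]
  have h1 := le_abs_self u
  have h2 := neg_abs_le u
  have h3 := abs_nonneg u
  constructor
  · have : max (-u - α) 0 ≤ |u| := max_le (by linarith) h3
    linarith [le_max_right (u - α) 0]
  · have : max (u - α) 0 ≤ |u| := max_le (by linarith) h3
    linarith [le_max_right (-u - α) 0]

/-- The decoder output coordinate, as a function of the Gaussian noise, is square-integrable. -/
theorem memLp_softThreshold_affine {α : ℝ} (hα : 0 < α) (w m s : ℝ) :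
    MemLp (fun ε => softThreshold α (w * (m + s * ε))) 2 (gaussianReal 0 1) := by
  have hid : MemLp (fun ε : ℝ => ε) 2 (gaussianReal 0 1) := memLp_id_gaussianReal 2
  have haff : MemLp (fun ε : ℝ => w * (m + s * ε)) 2 (gaussianReal 0 1) :=
    ((memLp_const m).add (hid.const_mul s)).const_mul w
  refine haff.of_le
    ((continuous_softThreshold hα).comp (by fun_prop)).aestronglyMeasurable ?_
  exact Filter.Eventually.of_forall fun ε => by
    simpa [Real.norm_eq_abs] using abs_softThreshold_le hα (w * (m + s * ε))

/-- Reflecting a standard Gaussian about `-m / 2` amounts to an exponential change of density. -/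
theorem integral_gaussianReal_reflect (F : ℝ → ℝ) (m : ℝ) :
    ∫ x, F (-m - x) ∂(gaussianReal 0 1) =
      ∫ x, F x * Real.exp (-(m * x + m ^ 2 / 2)) ∂(gaussianReal 0 1) := by
  rw [integral_gaussianReal_eq_integral_smul one_ne_zero,
    integral_gaussianReal_eq_integral_smul one_ne_zero,
    ← integral_sub_left_eq_self _ volume (-m)]
  refine integral_congr_ae (Filter.Eventually.of_forall fun x => ?_)
  simp only [smul_eq_mul, gaussianPDFReal, sub_sub_cancel]
  rw [mul_comm (F x), ← mul_assoc, mul_assoc _ (Real.exp _) (Real.exp _), ← Real.exp_add]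
  congr 3
  simp
  ring

theorem integrable_exp_abs_gaussianReal (c : ℝ) :
    Integrable (fun x => Real.exp (c * (|x| + 1))) (gaussianReal 0 1) := by
  have h := (integrable_exp_mul_abs (X := fun x : ℝ => x) (t := c)
    (integrable_exp_mul_gaussianReal (μ := 0) (v := 1) c)
    (integrable_exp_mul_gaussianReal (μ := 0) (v := 1) (-c))).mul_const (Real.exp c)
  refine h.congr (Filter.Eventually.of_forall fun x => ?_)
  simp only [← Real.exp_add]
  ring_nf

theorem memLp_exp_affine_gaussianReal (a b : ℝ) :
    MemLp (fun x => Real.exp (-(a * x + b))) 2 (gaussianReal 0 1) := by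
  rw [memLp_two_iff_integrable_sq (by fun_prop)]
  refine ((integrable_exp_mul_gaussianReal (μ := 0) (v := 1) (-(2 * a))).mul_const
    (Real.exp (-(2 * b)))).congr (Filter.Eventually.of_forall fun x => ?_)
  simp only [← Real.exp_add, ← Real.exp_nat_mul]
  congr 1
  push_cast
  ring

theorem abs_one_sub_exp_neg_le (y : ℝ) : |1 - Real.exp (-y)| ≤ |y| * Real.exp |y| := by
  have h1 : 1 ≤ Real.exp |y| := Real.one_le_exp (abs_nonneg y)
  rw [abs_le]
  constructor
  · have h2 : 1 - Real.exp (-y) = -(Real.exp (-y) * (1 - Real.exp y)) := by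
      rw [mul_sub, ← Real.exp_add]; simp
    have h3 : 1 - Real.exp y ≤ |y| := by
      linarith [Real.add_one_le_exp y, neg_abs_le y]
    have h4 : Real.exp (-y) ≤ Real.exp |y| := Real.exp_le_exp.2 (neg_le_abs y)
    have h5 : Real.exp (-y) * (1 - Real.exp y) ≤ Real.exp (-y) * |y| :=
      mul_le_mul_of_nonneg_left h3 (Real.exp_pos _).le
    nlinarith [abs_nonneg y]
  · nlinarith [Real.add_one_le_exp (-y), le_abs_self y, abs_nonneg y]

theorem two_mul_integral_softThreshold {α : ℝ} (hα : 0 < α) (w μ : ℝ) {σ : ℝ} (hσ : σ ≠ 0) :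
    2 * ∫ x, softThreshold α (w * (μ + σ * x)) ∂(gaussianReal 0 1) =
      ∫ x, softThreshold α (w * (μ + σ * x)) *
        (1 - Real.exp (-(2 * μ / σ * x + (2 * μ / σ) ^ 2 / 2))) ∂(gaussianReal 0 1) := by
  have hF := memLp_softThreshold_affine hα w μ σ
  have hodd : ∀ x, softThreshold α (w * (μ + σ * (-(2 * μ / σ) - x))) =
      -softThreshold α (w * (μ + σ * x)) := fun x => by
    rw [← softThreshold_neg]
    congr 1
    field_simp
    ring
  have h := integral_gaussianReal_reflect (fun x => softThreshold α (w * (μ + σ * x))) (2 * μ / σ)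
  simp only [hodd, integral_neg] at h
  have hFexp : Integrable (fun x => softThreshold α (w * (μ + σ * x)) *
      Real.exp (-(2 * μ / σ * x + (2 * μ / σ) ^ 2 / 2))) (gaussianReal 0 1) :=
    hF.integrable_mul (memLp_exp_affine_gaussianReal _ _)
  simp only [mul_sub, mul_one]
  rw [integral_sub (hF.integrable (by norm_num)) hFexp, ← h]
  ring

theorem abs_mul_one_sub_exp_le {F x m μ T : ℝ} (hm : |m| ≤ 4 * |μ|) (hm1 : |m| ≤ 1)
    (hF : F ≠ 0 → T ≤ |x|) :
    4 * |F * (1 - Real.exp (-(m * x + m ^ 2 / 2)))| ≤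
      F ^ 2 + 64 * μ ^ 2 * Real.exp (-(2 * T)) * Real.exp (6 * (|x| + 1)) := by
  by_cases h0 : F = 0
  · simp only [h0, zero_mul, abs_zero, mul_zero]
    positivity
  have hT := hF h0
  have hx := abs_nonneg x
  have hy : |m * x + m ^ 2 / 2| ≤ |m| * (|x| + 1) := by
    calc |m * x + m ^ 2 / 2| ≤ |m * x| + |m ^ 2 / 2| := abs_add_le _ _
      _ = |m| * |x| + |m| * |m| / 2 := by
        rw [abs_mul, abs_of_nonneg (by positivity : 0 ≤ m ^ 2 / 2), ← sq, sq_abs]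
      _ ≤ |m| * (|x| + 1) := by nlinarith [abs_nonneg m]
  have hy' : |m * x + m ^ 2 / 2| ≤ |x| + 1 := hy.trans (by nlinarith)
  have hexp : (|x| + 1) * Real.exp (|x| + 1) ≤ Real.exp (-T) * Real.exp (3 * (|x| + 1)) := by
    calc (|x| + 1) * Real.exp (|x| + 1) ≤ Real.exp (|x| + 1) * Real.exp (|x| + 1) := by
          gcongr; linarith [Real.add_one_le_exp (|x| + 1)]
      _ ≤ Real.exp (-T) * Real.exp (3 * (|x| + 1)) := by
          rw [← Real.exp_add, ← Real.exp_add]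
          exact Real.exp_le_exp.2 (by linarith)
  set E := Real.exp (-T) * Real.exp (3 * (|x| + 1)) with hE
  have hE2 : Real.exp (-(2 * T)) * Real.exp (6 * (|x| + 1)) = E ^ 2 := by
    rw [hE, mul_pow, ← Real.exp_nat_mul, ← Real.exp_nat_mul]
    congr 2 <;> push_cast <;> ring
  have hbound : |1 - Real.exp (-(m * x + m ^ 2 / 2))| ≤ 4 * |μ| * E := by
    calc _ ≤ |m * x + m ^ 2 / 2| * Real.exp |m * x + m ^ 2 / 2| := abs_one_sub_exp_neg_le _
      _ ≤ |m| * (|x| + 1) * Real.exp (|x| + 1) := by gcongr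
      _ = |m| * ((|x| + 1) * Real.exp (|x| + 1)) := by ring
      _ ≤ 4 * |μ| * E := by gcongr
  calc 4 * |F * (1 - Real.exp (-(m * x + m ^ 2 / 2)))|
      = 4 * (|F| * |1 - Real.exp (-(m * x + m ^ 2 / 2))|) := by rw [abs_mul]
    _ ≤ 4 * (|F| * (4 * |μ| * E)) := by gcongr
    _ ≤ |F| ^ 2 + 64 * |μ| ^ 2 * E ^ 2 := by nlinarith [sq_nonneg (|F| - 8 * |μ| * E)]
    _ = _ := by rw [sq_abs, sq_abs, mul_assoc _ (Real.exp _), hE2]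

/-- Near the collapsed configuration the mean of a decoder coordinate is controlled by its
second moment and the encoder mean. -/
theorem exists_abs_integral_softThreshold_le {α : ℝ} (hα : 0 < α) :
    ∃ r : ℝ, 0 < r ∧ r ≤ 1 / 4 ∧ ∀ w μ σ : ℝ, |w| < r → |μ| < r → |σ - 1| < r →
      8 * |∫ x, softThreshold α (w * (μ + σ * x)) ∂(gaussianReal 0 1)| ≤
        (∫ x, softThreshold α (w * (μ + σ * x)) ^ 2 ∂(gaussianReal 0 1)) + μ ^ 2 / 4 := by
  set C := ∫ x, Real.exp (6 * (|x| + 1)) ∂(gaussianReal 0 1) with hC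
  have hC0 : 0 ≤ C := integral_nonneg fun x => (Real.exp_pos _).le
  set T := 128 * C with hT
  have hT0 : 0 ≤ T := by positivity
  have hTC : Real.exp (-(2 * T)) * C ≤ 1 / 256 := by
    rw [Real.exp_neg, inv_mul_le_iff₀ (Real.exp_pos _)]
    linarith [Real.add_one_le_exp (2 * T)]
  refine ⟨min (1 / 4) (α / (2 * (T + 1))), by positivity, min_le_left _ _, ?_⟩
  intro w μ σ hw hμ hσ
  have hw' := hw.trans_le (min_le_right _ _)
  have hμ' := hμ.trans_le (min_le_left _ _)
  have hσ' := abs_lt.1 (hσ.trans_le (min_le_left _ _))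
  have hσ0 : 0 < σ := by linarith
  have hm : |2 * μ / σ| ≤ 4 * |μ| := by
    rw [abs_div, abs_mul, abs_two, abs_of_pos hσ0, div_le_iff₀ hσ0]
    nlinarith [abs_nonneg μ]
  have hsupp : ∀ x, softThreshold α (w * (μ + σ * x)) ≠ 0 → T ≤ |x| := by
    intro x hx
    by_contra! hlt
    refine hx (softThreshold_eq_zero ?_)
    have h1 : |μ + σ * x| ≤ 2 * (T + 1) := by
      calc |μ + σ * x| ≤ |μ| + |σ * x| := abs_add_le _ _
        _ = |μ| + σ * |x| := by rw [abs_mul, abs_of_pos hσ0]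
        _ ≤ 2 * (T + 1) := by nlinarith [abs_nonneg x]
    rw [abs_mul]
    calc |w| * |μ + σ * x| ≤ α / (2 * (T + 1)) * (2 * (T + 1)) := by gcongr
      _ = α := by field_simp
  have hF := memLp_softThreshold_affine hα w μ σ
  have hFsq := hF.integrable_sq
  have hG := (integrable_exp_abs_gaussianReal 6).const_mul (64 * μ ^ 2 * Real.exp (-(2 * T)))
  calc 8 * |∫ x, softThreshold α (w * (μ + σ * x)) ∂(gaussianReal 0 1)|
      = 4 * |2 * ∫ x, softThreshold α (w * (μ + σ * x)) ∂(gaussianReal 0 1)| := by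
        rw [abs_mul, abs_two]; ring
    _ ≤ 4 * ∫ x, |softThreshold α (w * (μ + σ * x)) *
        (1 - Real.exp (-(2 * μ / σ * x + (2 * μ / σ) ^ 2 / 2)))| ∂(gaussianReal 0 1) := by
        rw [two_mul_integral_softThreshold hα w μ hσ0.ne']
        gcongr
        exact abs_integral_le_integral_abs
    _ ≤ ∫ x, (softThreshold α (w * (μ + σ * x)) ^ 2 +
        64 * μ ^ 2 * Real.exp (-(2 * T)) * Real.exp (6 * (|x| + 1))) ∂(gaussianReal 0 1) := by
        rw [← integral_const_mul]
        refine integral_mono_of_nonneg (Filter.Eventually.of_forall fun x => by positivity)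
          (hFsq.add hG) (Filter.Eventually.of_forall fun x => ?_)
        exact abs_mul_one_sub_exp_le hm (by linarith) (hsupp x)
    _ = (∫ x, softThreshold α (w * (μ + σ * x)) ^ 2 ∂(gaussianReal 0 1)) +
        64 * μ ^ 2 * (Real.exp (-(2 * T)) * C) := by
        rw [integral_add hFsq hG, integral_const_mul]; ring
    _ ≤ _ := by nlinarith [sq_nonneg μ]

theorem eq_zero_of_integral_softThreshold_sq {α w μ σ : ℝ} (hα : 0 < α) (hσ : 0 < σ)
    (h : ∫ x, softThreshold α (w * (μ + σ * x)) ^ 2 ∂(gaussianReal 0 1) = 0) : w = 0 := by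
  by_contra hw
  have hae := (integral_eq_zero_iff_of_nonneg (fun x => sq_nonneg _)
    (memLp_softThreshold_affine hα w μ σ).integrable_sq).1 h
  have hcont : Continuous fun x => softThreshold α (w * (μ + σ * x)) ^ 2 :=
    ((continuous_softThreshold hα).comp (by fun_prop)).pow 2
  have hzero := (hcont.ae_eq_iff_eq volume continuous_const).1
    ((gaussianReal_absolutelyContinuous' 0 one_ne_zero).ae_eq hae)
  have hval := congrFun hzero (((α + 1) / w - μ) / σ)
  have harg : w * (μ + σ * (((α + 1) / w - μ) / σ)) = α + 1 := by field_simp; ring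
  simp only [harg] at hval
  exact (pow_pos (softThreshold_pos hα (lt_add_one α)) 2).ne' hval

theorem integral_sub_softThreshold_sq {α : ℝ} (hα : 0 < α) (w μ σ d b : ℝ) :
    Integrable (fun x => (d - softThreshold α (w * (μ + σ * x)) - b) ^ 2) (gaussianReal 0 1) ∧
    ∫ x, (d - softThreshold α (w * (μ + σ * x)) - b) ^ 2 ∂(gaussianReal 0 1) =
      (d - b) ^ 2 - 2 * (d - b) * (∫ x, softThreshold α (w * (μ + σ * x)) ∂(gaussianReal 0 1)) +
        ∫ x, softThreshold α (w * (μ + σ * x)) ^ 2 ∂(gaussianReal 0 1) := by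
  have hF := memLp_softThreshold_affine hα w μ σ
  have hFsq := hF.integrable_sq
  have h1 := (hF.integrable (by norm_num)).const_mul (2 * (d - b))
  have hc : Integrable (fun _ : ℝ => (d - b) ^ 2) (gaussianReal 0 1) := integrable_const _
  have heq : (fun x => (d - softThreshold α (w * (μ + σ * x)) - b) ^ 2) = fun x =>
      (d - b) ^ 2 - 2 * (d - b) * softThreshold α (w * (μ + σ * x)) +
        softThreshold α (w * (μ + σ * x)) ^ 2 := by
    funext x; ring
  rw [heq]
  have hlin : Integrable (fun x => (d - b) ^ 2 -
      2 * (d - b) * softThreshold α (w * (μ + σ * x))) (gaussianReal 0 1) := hc.sub h1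
  refine ⟨hlin.add hFsq, ?_⟩
  rw [integral_add hlin hFsq, integral_sub hc h1, integral_const_mul]
  simp

theorem vaeEnergy_collapsedConfig (α : ℝ) : vaeEnergy α collapsedConfig = 6 := by
  simp [vaeEnergy, collapsedConfig, Fin.sum_univ_two, dataPt, softThreshold]
  norm_num

/-- Fix `α > 0`. The posterior-collapsed configuration `W = (0,0)`,
`b = (0,0)`, `γ = 1`, `μ⁽¹⁾ = μ⁽²⁾ = 0`, `σ⁽¹⁾ = σ⁽²⁾ = 1` is a strict local
minimum of the VAE energy `L` over all parameters `(W, b, γ, μ⁽¹⁾, μ⁽²⁾, σ⁽¹⁾, σ⁽²⁾)`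
(within the admissible domain `γ > 0`, `σ⁽ⁱ⁾ > 0`). -/
theorem collapsed_config_strict_local_min (α : ℝ) (hα : 0 < α) :
    ∃ r : ℝ, 0 < r ∧ ∀ p : VAEParams,
      0 < p.2.2.1 → (∀ i, 0 < p.2.2.2.2 i) →
      p ≠ collapsedConfig → dist p collapsedConfig < r →
      vaeEnergy α collapsedConfig < vaeEnergy α p := by
  obtain ⟨r, hr, hr4, key⟩ := exists_abs_integral_softThreshold_le hα
  refine ⟨r, hr, ?_⟩
  rintro ⟨W, b, γ, μ, σ⟩ hγ hσ hne hdist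
  simp only at hγ hσ
  simp only [collapsedConfig, Prod.dist_eq, max_lt_iff, dist_pi_lt_iff hr, Real.dist_eq,
    sub_zero] at hdist
  obtain ⟨hW, hb, hγ1, hμ, hσ1⟩ := hdist
  set q : Fin 2 → Fin 2 → ℝ := fun i j =>
    ∫ x, softThreshold α (W j * (μ i + σ i * x)) ^ 2 ∂(gaussianReal 0 1) with hq
  have hq0 : ∀ i j, 0 ≤ q i j := fun i j => integral_nonneg fun x => sq_nonneg _
  have hterm : ∀ i j, (dataPt i j - b j) ^ 2 + q i j / 2 - μ i ^ 2 / 8 ≤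
      ∫ x, (dataPt i j - softThreshold α (W j * (μ i + σ i * x)) - b j) ^ 2
        ∂(gaussianReal 0 1) := by
    intro i j
    rw [(integral_sub_softThreshold_sq hα _ _ _ _ _).2]
    have hk := key (W j) (μ i) (σ i) (hW j) (hμ i) (hσ1 i)
    have hd : |dataPt i j - b j| ≤ 2 := by
      have hbj := abs_lt.1 ((hb j).trans_le hr4)
      rw [abs_le]
      fin_cases i <;> fin_cases j <;> simp [dataPt] at hbj ⊢ <;> constructor <;> linarith
    set h := ∫ x, softThreshold α (W j * (μ i + σ i * x)) ∂(gaussianReal 0 1)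
    have hdh : (dataPt i j - b j) * h ≤ 2 * |h| := by
      refine (le_abs_self _).trans ?_
      rw [abs_mul]
      gcongr
    simp only [hq]
    linarith
  have hsum : ∀ i, ∑ j, ((dataPt i j - b j) ^ 2 + q i j / 2 - μ i ^ 2 / 8) ≤
      ∫ x, (∑ j, (dataPt i j - softThreshold α (W j * (μ i + σ i * x)) - b j) ^ 2)
        ∂(gaussianReal 0 1) := by
    intro i
    rw [integral_finsetSum _ fun j _ => (integral_sub_softThreshold_sq hα _ _ _ _ _).1]
    exact Finset.sum_le_sum fun j _ => hterm i j
  rw [vaeEnergy_collapsedConfig]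
  by_contra! hle
  simp only [vaeEnergy, Fin.sum_univ_two (M := ℝ)] at hle hsum
  have hs0 := mul_le_mul_of_nonneg_left (hsum 0) (one_div_pos.2 hγ).le
  have hs1 := mul_le_mul_of_nonneg_left (hsum 1) (one_div_pos.2 hγ).le
  simp only [dataPt, Matrix.cons_val_zero, Matrix.cons_val_one] at hs0 hs1 hle
  have hγ2 := abs_lt.1 (hγ1.trans_le hr4)
  have hinv : 1 / γ ≤ 4 / 3 := by
    rw [div_le_iff₀ hγ]; linarith
  have hinv0 : 1 / 2 ≤ 1 / γ := by
    rw [le_div_iff₀ hγ]; linarith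
  have hlogγ : Real.log γ = -Real.log (1 / γ) := by simp
  rw [hlogγ] at hle
  have hg0 : 0 < 1 / γ := one_div_pos.2 hγ
  have hγlog := Real.log_le_sub_one_of_pos hg0
  have hσlog : ∀ i, Real.log (σ i ^ 2) ≤ σ i ^ 2 - 1 := fun i =>
    Real.log_le_sub_one_of_pos (pow_pos (hσ i) 2)
  set g := 1 / γ with hg
  have hμg : ∀ i, g * μ i ^ 2 ≤ 4 / 3 * μ i ^ 2 := fun i => by gcongr
  have hqg : ∀ i j, q i j ≤ 2 * (g * q i j) := fun i j => by
    nlinarith [hq0 i j]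
  have hbg : ∀ j, b j ^ 2 ≤ 2 * (g * b j ^ 2) := fun j => by
    nlinarith [sq_nonneg (b j)]
  have htotal : (b 0 ^ 2 + b 1 ^ 2) + (q 0 0 + q 0 1 + q 1 0 + q 1 1) / 4 +
      (μ 0 ^ 2 + μ 1 ^ 2) / 2 + 4 * (g - 1 - Real.log g) +
      (σ 0 ^ 2 - 1 - Real.log (σ 0 ^ 2)) + (σ 1 ^ 2 - 1 - Real.log (σ 1 ^ 2)) ≤ 0 := by
    linarith [hμg 0, hμg 1, hqg 0 0, hqg 0 1, hqg 1 0, hqg 1 1, hbg 0, hbg 1,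
      sq_nonneg (μ 0), sq_nonneg (μ 1)]
  have p1 := sq_nonneg (b 0)
  have p2 := sq_nonneg (b 1)
  have p3 := sq_nonneg (μ 0)
  have p4 := sq_nonneg (μ 1)
  have p5 := hq0 0 0
  have p6 := hq0 0 1
  have p7 := hq0 1 0
  have p8 := hq0 1 1
  have p9 := hσlog 0
  have p10 := hσlog 1
  have hb0 : ∀ j, b j = 0 := by
    intro j
    refine pow_eq_zero_iff two_ne_zero |>.1 ?_
    fin_cases j <;> simp only [Fin.zero_eta, Fin.mk_one] <;> linarith
  have hμ0 : ∀ i, μ i = 0 := by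
    intro i
    refine pow_eq_zero_iff two_ne_zero |>.1 ?_
    fin_cases i <;> simp only [Fin.zero_eta, Fin.mk_one] <;> linarith
  have hW0 : ∀ j, W j = 0 := by
    intro j
    refine eq_zero_of_integral_softThreshold_sq (μ := μ 0) hα (hσ 0) ?_
    change q 0 j = 0
    fin_cases j <;> simp only [Fin.zero_eta, Fin.mk_one] <;> linarith
  have hγ0 : γ = 1 := by
    by_contra hγne
    have := Real.log_lt_sub_one_of_pos hg0 (by simpa [hg] using hγne)
    linarith
  have hσ0 : ∀ i, σ i = 1 := by
    intro i
    by_contra hσne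
    have := Real.log_lt_sub_one_of_pos (pow_pos (hσ i) 2)
      (fun h => hσne ((pow_eq_one_iff_of_nonneg (hσ i).le two_ne_zero).1 h))
    fin_cases i <;> simp only [Fin.zero_eta, Fin.mk_one] at this <;> linarith
  exact hne (by
    rw [funext hW0, funext hb0, hγ0, funext hμ0, funext hσ0]
    rfl)
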